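/- arXiv:2309.05611 — 2 statements merged into one kernel-verified Lean document; each statement's English description precedes it below -/
import Mathlib

section
/- Let k ≥ 2, m₁,…,m_k ≥ 2 and m = m₁ + ⋯ + m_k − (k−1). The map p sending ((x₁,z₁),…,(x_k,z_k)) ∈ S^{m₁} × ⋯ × S^{m_k} to (x₁, x₂, …, x_k, z₁z₂⋯z_k)/√(|x₁|² + ⋯ + |x_k|² + |z₁z₂⋯z_k|²), regarded as a point of the unit sphere S^m in ℝ^{m₁−1} × ⋯ × ℝ^{m_k−1} × ℂ ≅ ℝ^{m+1}, is continuous, surjective, constant on T^{k−1}-orbits, and the induced map from the orbit space (S^{m₁} × ⋯ × S^{m_k})/T^{k−1} to S^m is a homeomorphism. -/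
open scoped BigOperators

noncomputable section

def chainExt (k : ℕ) {G : Type*} [One G] (r : Fin (k - 1) → G) (j : ℕ) : G :=
  if h : 1 ≤ j ∧ j ≤ k - 1 then r ⟨j - 1, by omega⟩ else 1

/-- The sphere `S^{m i} = {(x, z) ∈ ℝ^{m i - 1} × ℂ : |x|² + |z|² = 1}`. -/
abbrev TSphere (n : ℕ) : Type :=
  {p : EuclideanSpace ℝ (Fin n) × ℂ // ‖p.1‖ ^ 2 + ‖p.2‖ ^ 2 = 1}

/-- The orbit relation of the action of `T^{k-1}` on `S^{m₁} × ⋯ × S^{m_k}`. -/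
def tRel (k : ℕ) (m : Fin k → ℕ) (a b : ∀ i : Fin k, TSphere (m i - 1)) : Prop :=
  ∃ r : Fin (k - 1) → ℂ, (∀ j, ‖r j‖ = 1) ∧
    ∀ i : Fin k, (b i).1.1 = (a i).1.1 ∧
      (b i).1.2 = chainExt k r (i : ℕ) * (a i).1.2 * (chainExt k r ((i : ℕ) + 1))⁻¹

/-- The ambient Euclidean space `ℝ^{m₁-1} × ⋯ × ℝ^{m_k-1} × ℂ ≅ ℝ^{m+1}` with its
`L²`-norm, containing the target sphere `S^m`, `m = m₁ + ⋯ + m_k - (k-1)`. -/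
abbrev TTarget (k : ℕ) (m : Fin k → ℕ) : Type :=
  WithLp 2 ((PiLp 2 fun i : Fin k => EuclideanSpace ℝ (Fin (m i - 1))) × ℂ)

/-- The unnormalized vector `(x₁, …, x_k, z₁z₂⋯z_k)`. -/
def tVec (k : ℕ) (m : Fin k → ℕ) (a : ∀ i : Fin k, TSphere (m i - 1)) : TTarget k m :=
  (WithLp.equiv 2 _).symm
    ((WithLp.equiv 2 _).symm (fun i => (a i).1.1), (List.ofFn fun i => (a i).1.2).prod)

/-- The map `p : ((x₁,z₁),…,(x_k,z_k)) ↦ (x₁, …, x_k, z₁z₂⋯z_k)/|(x₁, …, x_k, z₁z₂⋯z_k)|`. -/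
def tProj (k : ℕ) (m : Fin k → ℕ) (a : ∀ i : Fin k, TSphere (m i - 1)) : TTarget k m :=
  ‖tVec k m a‖⁻¹ • tVec k m a

variable {k : ℕ} {m : Fin k → ℕ}

theorem tVec_fst_apply (a : ∀ i : Fin k, TSphere (m i - 1)) (i : Fin k) :
    (tVec k m a).fst i = (a i).1.1 := rfl

theorem tVec_snd (a : ∀ i : Fin k, TSphere (m i - 1)) :
    (tVec k m a).snd = ∏ i, (a i).1.2 := List.prod_ofFn

theorem tTarget_ext {x y : TTarget k m} (h₁ : ∀ i, x.fst i = y.fst i) (h₂ : x.snd = y.snd) :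
    x = y :=
  (WithLp.equiv 2 _).injective (Prod.ext (PiLp.ext h₁) h₂)

theorem continuous_tVec : Continuous (tVec k m) := by
  have h : tVec k m = fun a => WithLp.toLp 2
      (WithLp.toLp 2 (fun i => (a i).1.1), ∏ i, (a i).1.2) :=
    funext fun a => tTarget_ext (fun _ => rfl) (tVec_snd a)
  rw [h]
  fun_prop

theorem tVec_ne_zero (a : ∀ i : Fin k, TSphere (m i - 1)) : tVec k m a ≠ 0 := by
  intro h
  have hx : ∀ i, (a i).1.1 = 0 := fun i => by rw [← tVec_fst_apply a i, h]; rfl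
  have hz : ∏ i, (a i).1.2 = 0 := by rw [← tVec_snd, h]; rfl
  obtain ⟨i, -, hi⟩ := Finset.prod_eq_zero_iff.1 hz
  simpa [hx i, hi] using (a i).2

theorem continuous_tProj : Continuous (tProj k m) :=
  (continuous_tVec.norm.inv₀ fun a => norm_ne_zero_iff.2 (tVec_ne_zero a)).smul continuous_tVec

theorem norm_tProj (a : ∀ i : Fin k, TSphere (m i - 1)) : ‖tProj k m a‖ = 1 := by
  rw [tProj, norm_smul, norm_inv, norm_norm,
    inv_mul_cancel₀ (norm_ne_zero_iff.2 (tVec_ne_zero a))]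

/-- A ray from the origin meets the unnormalized image of the product of spheres. -/
theorem exists_scale_prod_sqrt {ι : Type*} [Fintype ι] (n : ι → ℝ) (hn : ∀ i, 0 ≤ n i)
    (w : ℝ) (hw : 0 ≤ w) (h : ∑ i, n i ^ 2 + w ^ 2 = 1) :
    ∃ s : ℝ, 0 < s ∧ (∀ i, s * n i ≤ 1) ∧ ∏ i, √(1 - (s * n i) ^ 2) = s * w := by
  by_cases h0 : ∀ i, n i = 0
  · refine ⟨1, one_pos, fun i => by simp [h0 i], ?_⟩
    simp only [h0] at h ⊢
    have : w = 1 := by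
      have h' : w ^ 2 = 1 := by simpa using h
      nlinarith
    simp [this]
  · push Not at h0
    obtain ⟨j, hj⟩ := h0
    obtain ⟨i₀, -, hi₀⟩ := Finset.exists_max_image Finset.univ n ⟨j, Finset.mem_univ j⟩
    have hpos : 0 < n i₀ :=
      ((hn j).lt_of_ne' hj).trans_le (hi₀ j (Finset.mem_univ j))
    let f : ℝ → ℝ := fun s => ∏ i, √(1 - (s * n i) ^ 2) - s * w
    have hf : Continuous f := by fun_prop
    have hf0 : f 0 = 1 := by simp [f]
    have hfT : f (n i₀)⁻¹ ≤ 0 := by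
      have : ∏ i, √(1 - ((n i₀)⁻¹ * n i) ^ 2) = 0 :=
        Finset.prod_eq_zero (Finset.mem_univ i₀) (by simp [inv_mul_cancel₀ hpos.ne'])
      simp only [f, this, zero_sub, neg_nonpos]
      positivity
    obtain ⟨s, ⟨hs0, hsT⟩, hs⟩ := intermediate_value_Icc' (inv_pos.2 hpos).le hf.continuousOn
      ⟨hfT, by rw [hf0]; exact zero_le_one⟩
    have hne : s ≠ 0 := by
      rintro rfl
      rw [hf0] at hs
      exact one_ne_zero hs
    refine ⟨s, hs0.lt_of_ne' hne, fun i => ?_, sub_eq_zero.1 hs⟩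
    calc s * n i ≤ (n i₀)⁻¹ * n i₀ := by
          gcongr
          exacts [hn i, hi₀ i (Finset.mem_univ i)]
      _ = 1 := inv_mul_cancel₀ hpos.ne'

theorem exists_norm_eq_prod_eq {ι : Type*} [Fintype ι] [Nonempty ι] (ρ : ι → ℝ)
    (hρ : ∀ i, 0 ≤ ρ i) (c : ℂ) (h : ∏ i, ρ i = ‖c‖) :
    ∃ z : ι → ℂ, (∀ i, ‖z i‖ = ρ i) ∧ ∏ i, z i = c := by
  classical
  obtain ⟨i₀⟩ := ‹Nonempty ι›
  refine ⟨fun i => ρ i * if i = i₀ then Complex.exp (c.arg * Complex.I) else 1, fun i => ?_, ?_⟩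
  · rw [norm_mul, Complex.norm_real, Real.norm_of_nonneg (hρ i)]
    split_ifs <;> simp [Complex.norm_exp_ofReal_mul_I]
  · rw [Finset.prod_mul_distrib, ← Complex.ofReal_prod, h]
    simp [Complex.norm_mul_exp_arg_mul_I]

theorem exists_unit_mul_eq {ι : Type*} [Fintype ι] (a b : ι → ℂ) (h : ∀ i, ‖a i‖ = ‖b i‖)
    (hp : ∏ i, a i = ∏ i, b i) :
    ∃ u : ι → ℂ, (∀ i, ‖u i‖ = 1) ∧ ∏ i, u i = 1 ∧ ∀ i, b i = u i * a i := by
  classical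
  have hv : ∀ i, ∃ v : ℂ, ‖v‖ = 1 ∧ b i = v * a i := fun i => by
    by_cases ha : a i = 0
    · have hb : b i = 0 := by rw [← norm_eq_zero, ← h i, ha, norm_zero]
      exact ⟨1, norm_one, by simp [ha, hb]⟩
    · refine ⟨b i / a i, ?_, (div_mul_cancel₀ _ ha).symm⟩
      rw [norm_div, ← h i, div_self (norm_ne_zero_iff.2 ha)]
  choose v hv1 hv using hv
  by_cases h0 : ∃ i, a i = 0
  · obtain ⟨i₀, hi₀⟩ := h0
    have hP : ‖∏ i, v i‖ = 1 := by simp [norm_prod, hv1]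
    refine ⟨fun i => v i * if i = i₀ then (∏ i, v i)⁻¹ else 1, fun i => ?_, ?_, fun i => ?_⟩
    · dsimp only
      split_ifs <;> simp [hv1, hP, -norm_prod]
    · rw [Finset.prod_mul_distrib]
      simp only [Finset.prod_ite_eq', Finset.mem_univ, if_true]
      exact mul_inv_cancel₀ (norm_ne_zero_iff.1 (by rw [hP]; exact one_ne_zero))
    · dsimp only
      split_ifs with hi
      · subst hi
        simp [hv i, hi₀]
      · rw [mul_one, hv i]
  · push Not at h0
    refine ⟨v, hv1, ?_, hv⟩
    refine mul_right_cancel₀ (Finset.prod_ne_zero_iff.2 fun i _ => h0 i) (?_ : _ = 1 * ∏ i, a i)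
    rw [← Finset.prod_mul_distrib, one_mul, hp]
    exact Finset.prod_congr rfl fun i _ => (hv i).symm

theorem tProj_surjective [NeZero k] (y : TTarget k m) (hy : ‖y‖ = 1) :
    ∃ a, tProj k m a = y := by
  have hsum : ∑ i, ‖y.fst i‖ ^ 2 + ‖y.snd‖ ^ 2 = 1 := by
    rw [← PiLp.norm_sq_eq_of_L2, ← WithLp.prod_norm_sq_eq_of_L2, hy, one_pow]
  obtain ⟨s, hs, hs1, hprod⟩ := exists_scale_prod_sqrt (fun i => ‖y.fst i‖)
    (fun i => norm_nonneg _) _ (norm_nonneg _) hsum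
  obtain ⟨z, hz, hzp⟩ := exists_norm_eq_prod_eq _ (fun i => Real.sqrt_nonneg _) ((s : ℂ) * y.snd)
    (hprod.trans (by rw [norm_mul, Complex.norm_real, Real.norm_of_nonneg hs.le]))
  let a : ∀ i : Fin k, TSphere (m i - 1) := fun i => ⟨(s • y.fst i, z i), by
    have h1 : (s * ‖y.fst i‖) ^ 2 ≤ 1 :=
      pow_le_one₀ (mul_nonneg hs.le (norm_nonneg _)) (hs1 i)
    rw [hz i, Real.sq_sqrt (sub_nonneg.2 h1), norm_smul, Real.norm_of_nonneg hs.le]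
    ring⟩
  have ha : tVec k m a = s • y := by
    refine tTarget_ext (fun i => rfl) ?_
    rw [tVec_snd]
    exact hzp
  refine ⟨a, ?_⟩
  rw [tProj, ha, norm_smul, hy, Real.norm_of_nonneg hs.le, mul_one, inv_smul_smul₀ hs.ne']

theorem norm_chainExt {r : Fin (k - 1) → ℂ} (hr : ∀ j, ‖r j‖ = 1) (j : ℕ) :
    ‖chainExt k r j‖ = 1 := by
  unfold chainExt
  split_ifs
  exacts [hr _, norm_one]

theorem tVec_eq_of_tRel {a b : ∀ i : Fin k, TSphere (m i - 1)} (h : tRel k m a b) :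
    tVec k m a = tVec k m b := by
  obtain ⟨r, hr, h⟩ := h
  have hne : ∀ j, chainExt k r j ≠ 0 := fun j =>
    norm_ne_zero_iff.1 (by rw [norm_chainExt hr]; exact one_ne_zero)
  have htel : ∀ n, ∏ j ∈ Finset.range n, chainExt k r j * (chainExt k r (j + 1))⁻¹
      = chainExt k r 0 * (chainExt k r n)⁻¹ := fun n => by
    induction n with
    | zero => simp [hne]
    | succ n ih =>
      rw [Finset.prod_range_succ, ih, mul_assoc, inv_mul_cancel_left₀ (hne n)]
  refine tTarget_ext (fun i => (h i).1.symm) ?_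
  rw [tVec_snd, tVec_snd]
  have hk : ∏ i : Fin k, chainExt k r i * (chainExt k r (i + 1))⁻¹ = 1 := by
    rw [Fin.prod_univ_eq_prod_range (fun j => chainExt k r j * (chainExt k r (j + 1))⁻¹), htel]
    rcases Nat.eq_zero_or_pos k with rfl | hk
    · simp [hne]
    · have h0 : chainExt k r 0 = 1 := dif_neg (by omega)
      have h1 : chainExt k r k = 1 := dif_neg (by omega)
      simp [h0, h1]
  calc ∏ i, (a i).1.2
      = ∏ i : Fin k, (chainExt k r i * (chainExt k r (i + 1))⁻¹) * (a i).1.2 := by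
        rw [Finset.prod_mul_distrib, hk, one_mul]
    _ = ∏ i, (b i).1.2 := Finset.prod_congr rfl fun i _ => by rw [(h i).2]; ring

theorem tProj_eq_of_tRel {a b : ∀ i : Fin k, TSphere (m i - 1)} (h : tRel k m a b) :
    tProj k m a = tProj k m b := by
  rw [tProj, tProj, tVec_eq_of_tRel h]

theorem tRel_of_tVec_eq {a b : ∀ i : Fin k, TSphere (m i - 1)}
    (h : tVec k m a = tVec k m b) : tRel k m a b := by
  have hx : ∀ i, (a i).1.1 = (b i).1.1 := fun i => by
    rw [← tVec_fst_apply, ← tVec_fst_apply, h]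
  have hn : ∀ i, ‖(a i).1.2‖ = ‖(b i).1.2‖ := fun i => by
    rw [← sq_eq_sq₀ (norm_nonneg _) (norm_nonneg _)]
    have ha := (a i).2
    have hb := (b i).2
    rw [hx i] at ha
    linarith
  obtain ⟨u, hu, hup, hub⟩ := exists_unit_mul_eq (fun i => (a i).1.2) (fun i => (b i).1.2) hn
    (by rw [← tVec_snd, ← tVec_snd, h])
  let v : ℕ → ℂ := fun j => if hj : j < k then u ⟨j, hj⟩ else 1
  have hv : ∀ j, ‖v j‖ = 1 := fun j => by
    dsimp only [v]
    split_ifs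
    exacts [hu _, norm_one]
  have hvu : ∀ i : Fin k, v i = u i := fun i => dif_pos i.2
  let R : ℕ → ℂ := fun j => ∏ l ∈ Finset.range j, (v l)⁻¹
  have hR : ∀ j, ‖R j‖ = 1 := fun j => by simp [R, norm_prod, hv]
  have hRk : R k = 1 := by
    simp only [R, Finset.prod_inv_distrib]
    rw [← Fin.prod_univ_eq_prod_range, Finset.prod_congr rfl fun i _ => hvu i, hup, inv_one]
  have hext : ∀ j ≤ k, chainExt k (fun l => R (l + 1)) j = R j := fun j hj => by
    unfold chainExt
    split_ifs with h
    · simp only [Nat.sub_add_cancel h.1]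
    · rcases Nat.eq_zero_or_pos j with rfl | hj0
      · simp [R]
      · rw [show j = k by omega, hRk]
  refine ⟨fun j => R (j + 1), fun j => hR _, fun i => ⟨(hx i).symm, ?_⟩⟩
  have hRne : R i ≠ 0 := norm_ne_zero_iff.1 (by rw [hR]; exact one_ne_zero)
  rw [hext i i.2.le, hext (i + 1) i.2, hub i,
    show R (i + 1) = R i * (v i)⁻¹ from Finset.prod_range_succ _ _, hvu, mul_inv, inv_inv]
  field_simp

theorem scale_le_one_of_tVec_eq_smul {a b : ∀ i : Fin k, TSphere (m i - 1)} {c : ℝ}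
    (h : tVec k m a = c • tVec k m b) : c ≤ 1 := by
  by_contra! hc
  have hc0 : 0 ≤ c := by linarith
  have hx : ∀ i, ‖(a i).1.1‖ = c * ‖(b i).1.1‖ := fun i => by
    rw [← tVec_fst_apply, h, ← tVec_fst_apply b, WithLp.smul_fst, PiLp.smul_apply, norm_smul,
      Real.norm_of_nonneg hc0]
  have hz : ∏ i, ‖(a i).1.2‖ = c * ∏ i, ‖(b i).1.2‖ := by
    rw [← norm_prod, ← norm_prod, ← tVec_snd, ← tVec_snd, h, WithLp.smul_snd, norm_smul,
      Real.norm_of_nonneg hc0]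
  have hle : ∏ i, ‖(a i).1.2‖ ≤ ∏ i, ‖(b i).1.2‖ :=
    Finset.prod_le_prod (fun i _ => norm_nonneg _) fun i _ => by
      refine (sq_le_sq₀ (norm_nonneg _) (norm_nonneg _)).1 ?_
      have ha := (a i).2
      have hb := (b i).2
      rw [hx i] at ha
      nlinarith [sq_nonneg ‖(b i).1.1‖,
        mul_nonneg (sq_nonneg ‖(b i).1.1‖) (by nlinarith : 0 ≤ c ^ 2 - 1)]
  have h0 : ∏ i, ‖(b i).1.2‖ = 0 :=
    le_antisymm (by nlinarith) (Finset.prod_nonneg fun i _ => norm_nonneg _)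
  obtain ⟨i, -, hi⟩ := Finset.prod_eq_zero_iff.1 h0
  have ha := (a i).2
  have hb := (b i).2
  rw [hi] at hb
  rw [hx i] at ha
  have hb1 : ‖(b i).1.1‖ ^ 2 = 1 := by linarith
  rw [mul_pow, hb1] at ha
  nlinarith [sq_nonneg ‖(a i).1.2‖]

theorem tRel_of_tProj_eq {a b : ∀ i : Fin k, TSphere (m i - 1)}
    (h : tProj k m a = tProj k m b) : tRel k m a b := by
  have ha := norm_pos_iff.2 (tVec_ne_zero a)
  have hb := norm_pos_iff.2 (tVec_ne_zero b)
  have key : ∀ {a b : ∀ i : Fin k, TSphere (m i - 1)}, tProj k m a = tProj k m b →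
      tVec k m a = (‖tVec k m a‖ / ‖tVec k m b‖) • tVec k m b := fun {a b} h => by
    rw [div_eq_mul_inv, mul_smul, ← tProj, ← h, tProj,
      smul_inv_smul₀ (norm_ne_zero_iff.2 (tVec_ne_zero a))]
  have h1 := (div_le_one hb).1 (scale_le_one_of_tVec_eq_smul (key h))
  have h2 := (div_le_one ha).1 (scale_le_one_of_tVec_eq_smul (key h.symm))
  refine tRel_of_tVec_eq ?_
  rw [key h, le_antisymm h1 h2, div_self hb.ne', one_smul]

instance compactSpace_tSphere (n : ℕ) : CompactSpace (TSphere n) := by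
  refine isCompact_iff_compactSpace.1 (Metric.isCompact_of_isClosed_isBounded
    (s := {p : EuclideanSpace ℝ (Fin n) × ℂ | ‖p.1‖ ^ 2 + ‖p.2‖ ^ 2 = 1})
    (isClosed_eq (by fun_prop) continuous_const) ?_)
  refine (Metric.isBounded_closedBall (x := 0) (r := 1)).subset fun p hp => ?_
  rw [Set.mem_ofPred_eq] at hp
  rw [mem_closedBall_zero_iff, Prod.norm_def]
  refine max_le ?_ ?_ <;> nlinarith [norm_nonneg p.1, norm_nonneg p.2]

/-- `p` is continuous, takes values in the unit sphere `S^m`, is surjective onto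
`S^m`, is constant on `T^{k-1}`-orbits, and induces a homeomorphism
`(S^{m₁} × ⋯ × S^{m_k})/T^{k-1} ≃ₜ S^m`. -/
theorem stmt3 (k : ℕ) (hk : 2 ≤ k) (m : Fin k → ℕ) (hm : ∀ i, 2 ≤ m i) :
    Continuous (tProj k m) ∧
    (∀ a, ‖tProj k m a‖ = 1) ∧
    (∀ y : TTarget k m, ‖y‖ = 1 → ∃ a, tProj k m a = y) ∧
    (∀ a b, tRel k m a b → tProj k m a = tProj k m b) ∧
    ∃ h : Quot (tRel k m) ≃ₜ Metric.sphere (0 : TTarget k m) 1,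
      ∀ a, (h (Quot.mk _ a)).1 = tProj k m a := by
  have : NeZero k := ⟨by omega⟩
  have hmem : ∀ a, tProj k m a ∈ Metric.sphere (0 : TTarget k m) 1 := fun a =>
    mem_sphere_zero_iff_norm.2 (norm_tProj a)
  let q : Quot (tRel k m) → Metric.sphere (0 : TTarget k m) 1 :=
    Quot.lift (fun a => ⟨tProj k m a, hmem a⟩) fun _ _ h => Subtype.ext (tProj_eq_of_tRel h)
  have hq : Continuous q := continuous_quot_lift _ (continuous_tProj.subtype_mk hmem)
  have hinj : Function.Injective q := by
    rintro ⟨a⟩ ⟨b⟩ h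
    exact Quot.sound (tRel_of_tProj_eq (Subtype.ext_iff.1 h))
  have hsurj : Function.Surjective q := fun y =>
    (tProj_surjective y.1 (mem_sphere_zero_iff_norm.1 y.2)).imp' (Quot.mk _)
      fun _ h => Subtype.ext h
  exact ⟨continuous_tProj, norm_tProj, tProj_surjective, fun _ _ => tProj_eq_of_tRel,
    Continuous.homeoOfEquivCompactToT2 (f := Equiv.ofBijective q ⟨hinj, hsurj⟩) hq, fun _ => rfl⟩
end
end

section
/- Let k ≥ 2, m₁,…,m_k ≥ 4 and m = m₁ + ⋯ + m_k − 3(k−1). The map p sending ((x₁,q₁),…,(x_k,q_k)) ∈ S^{m₁} × ⋯ × S^{m_k} to (x₁, x₂, …, x_k, q₁q₂⋯q_k)/√(|x₁|² + ⋯ + |x_k|² + |q₁q₂⋯q_k|²), regarded as a point of the unit sphere S^m in ℝ^{m₁−3} × ⋯ × ℝ^{m_k−3} × ℍ ≅ ℝ^{m+1}, is continuous, surjective, constant on Sp(1)^{k−1}-orbits, and the induced map from the orbit space (S^{m₁} × ⋯ × S^{m_k})/Sp(1)^{k−1} to S^m is a homeomorphism. -/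
open scoped BigOperators

noncomputable section

/-- The sphere `S^{m i} = {(x, q) ∈ ℝ^{m i - 3} × ℍ : |x|² + |q|² = 1}`. -/
abbrev SpSphere (n : ℕ) : Type :=
  {p : EuclideanSpace ℝ (Fin n) × Quaternion ℝ // ‖p.1‖ ^ 2 + ‖p.2‖ ^ 2 = 1}

/-- The orbit relation of the action of `Sp(1)^{k-1}` on `S^{m₁} × ⋯ × S^{m_k}`. -/
def spRel (k : ℕ) (m : Fin k → ℕ) (a b : ∀ i : Fin k, SpSphere (m i - 3)) : Prop :=
  ∃ r : Fin (k - 1) → Quaternion ℝ, (∀ j, ‖r j‖ = 1) ∧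
    ∀ i : Fin k, (b i).1.1 = (a i).1.1 ∧
      (b i).1.2 = chainExt k r (i : ℕ) * (a i).1.2 * (chainExt k r ((i : ℕ) + 1))⁻¹

/-- The ambient Euclidean space `ℝ^{m₁-3} × ⋯ × ℝ^{m_k-3} × ℍ ≅ ℝ^{m+1}` with its
`L²`-norm, containing the target sphere `S^m`, `m = m₁ + ⋯ + m_k - 3(k-1)`. -/
abbrev SpTarget (k : ℕ) (m : Fin k → ℕ) : Type :=
  WithLp 2 ((PiLp 2 fun i : Fin k => EuclideanSpace ℝ (Fin (m i - 3))) × Quaternion ℝ)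

/-- The unnormalized vector `(x₁, …, x_k, q₁q₂⋯q_k)`. -/
def spVec (k : ℕ) (m : Fin k → ℕ) (a : ∀ i : Fin k, SpSphere (m i - 3)) : SpTarget k m :=
  (WithLp.equiv 2 _).symm
    ((WithLp.equiv 2 _).symm (fun i => (a i).1.1), (List.ofFn fun i => (a i).1.2).prod)

/-- The map `p : ((x₁,q₁),…,(x_k,q_k)) ↦ (x₁, …, x_k, q₁q₂⋯q_k)/|(x₁, …, x_k, q₁q₂⋯q_k)|`. -/
def spProj (k : ℕ) (m : Fin k → ℕ) (a : ∀ i : Fin k, SpSphere (m i - 3)) : SpTarget k m :=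
  ‖spVec k m a‖⁻¹ • spVec k m a

theorem norm_prod_ofFn {R : Type*} [NormedDivisionRing R] {n : ℕ} (q : Fin n → R) :
    ‖(List.ofFn q).prod‖ = ∏ i, ‖q i‖ := by
  change (normHom : R →*₀ ℝ) _ = _
  rw [map_list_prod, List.map_ofFn, List.prod_ofFn]
  rfl

theorem prod_ofFn_telescope {R : Type*} [DivisionRing R] {n : ℕ} (q : Fin n → R) (s : ℕ → R)
    (hs : ∀ j, s j ≠ 0) :
    (List.ofFn fun i : Fin n => s i * q i * (s (i + 1))⁻¹).prod =
      s 0 * (List.ofFn q).prod * (s n)⁻¹ := by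
  induction n generalizing s with
  | zero => simp [hs 0]
  | succ n ih =>
    have h := ih (fun i => q i.succ) (fun j => s (j + 1)) fun j => hs (j + 1)
    simp only [List.ofFn_succ, List.prod_cons, Fin.val_succ, Fin.val_zero, zero_add] at h ⊢
    rw [h]
    simp only [mul_assoc]
    rw [inv_mul_cancel_left₀ (hs 1)]

theorem exists_unit_chain_of_prod_eq {R : Type*} [NormedDivisionRing R] {n : ℕ}
    (q q' : Fin n → R) (hq : ∀ i, ‖q' i‖ = ‖q i‖) (u : R) (hu : ‖u‖ = 1)
    (h : (List.ofFn q').prod = u * (List.ofFn q).prod) :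
    ∃ s : ℕ → R, (∀ j, ‖s j‖ = 1) ∧ s 0 = u ∧ s n = 1 ∧
      ∀ i : Fin n, q' i = s i * q i * (s (i + 1))⁻¹ := by
  induction n generalizing u with
  | zero =>
    have hu1 : u = 1 := by simpa using h.symm
    exact ⟨fun _ => 1, by simp, hu1.symm, rfl, fun i => i.elim0⟩
  | succ n ih =>
    set P := (List.ofFn fun i : Fin n => q i.succ).prod with hP
    set P' := (List.ofFn fun i : Fin n => q' i.succ).prod with hP'
    rw [List.ofFn_succ, List.ofFn_succ, List.prod_cons, List.prod_cons, ← hP, ← hP'] at h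
    have hPP : ‖P'‖ = ‖P‖ := by
      rw [hP, hP', norm_prod_ofFn, norm_prod_ofFn]
      exact Finset.prod_congr rfl fun i _ => hq i.succ
    obtain ⟨v, hv, hvP, hvq⟩ : ∃ v : R, ‖v‖ = 1 ∧ P' = v * P ∧ q' 0 = u * q 0 * v⁻¹ := by
      have hu0 : u ≠ 0 := norm_ne_zero_iff.1 (by simp [hu])
      by_cases h0 : q 0 = 0
      · have h0' : q' 0 = 0 := by rw [← norm_eq_zero, hq, h0, norm_zero]
        by_cases hP0 : P = 0
        · have hP0' : P' = 0 := by rw [← norm_eq_zero, hPP, hP0, norm_zero]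
          exact ⟨1, norm_one, by simp [hP0, hP0'], by simp [h0, h0']⟩
        · refine ⟨P' * P⁻¹, ?_, by simp [hP0], by simp [h0, h0']⟩
          rw [norm_mul, norm_inv, hPP, mul_inv_cancel₀ (norm_ne_zero_iff.2 hP0)]
      · have h0' : q' 0 ≠ 0 := by rwa [← norm_ne_zero_iff, hq, norm_ne_zero_iff]
        refine ⟨(q' 0)⁻¹ * (u * q 0), ?_, ?_, ?_⟩
        · rw [norm_mul, norm_mul, norm_inv, hu, hq, one_mul,
            inv_mul_cancel₀ (norm_ne_zero_iff.2 h0)]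
        · rw [mul_assoc, mul_assoc, ← h, inv_mul_cancel_left₀ h0']
        · rw [mul_inv_rev, inv_inv, mul_inv_cancel_left₀ (mul_ne_zero hu0 h0)]
    obtain ⟨s, hs, hs0, hsn, hsq⟩ := ih (fun i => q i.succ) (fun i => q' i.succ)
      (fun i => hq i.succ) v hv hvP
    refine ⟨fun j => Nat.casesOn j u s, ?_, rfl, hsn, ?_⟩
    · rintro (_ | j)
      exacts [hu, hs j]
    · intro i
      induction i using Fin.cases with
      | zero => simpa [hs0] using hvq
      | succ i => simpa using hsq i

theorem exists_prod_ofFn_eq {n : ℕ} (hn : n ≠ 0) (c : Fin n → ℝ) (hc : ∀ i, 0 ≤ c i)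
    (Q : Quaternion ℝ) (hQ : ∏ i, c i = ‖Q‖) :
    ∃ q : Fin n → Quaternion ℝ, (∀ i, ‖q i‖ = c i) ∧ (List.ofFn q).prod = Q := by
  obtain ⟨n, rfl⟩ := Nat.exists_eq_succ_of_ne_zero hn
  obtain ⟨u, hu, huQ⟩ : ∃ u : Quaternion ℝ, ‖u‖ = 1 ∧ u * ((‖Q‖ : ℝ) : Quaternion ℝ) = Q := by
    by_cases h : Q = 0
    · exact ⟨1, norm_one, by simp [h]⟩
    · have hQ0 : ((‖Q‖ : ℝ) : Quaternion ℝ) ≠ 0 := by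
        rw [← norm_ne_zero_iff, Quaternion.norm_coe]
        simpa using h
      refine ⟨Q * ((‖Q‖ : ℝ) : Quaternion ℝ)⁻¹, ?_, inv_mul_cancel_right₀ hQ0 Q⟩
      rw [norm_mul, norm_inv, Quaternion.norm_coe, norm_norm,
        mul_inv_cancel₀ (norm_ne_zero_iff.2 h)]
  refine ⟨Fin.cons (u * (c 0 : ℝ)) fun i => (c i.succ : ℝ), fun i => ?_, ?_⟩
  · induction i using Fin.cases with
    | zero => simp [hu, abs_of_nonneg (hc 0)]
    | succ i => simp [abs_of_nonneg (hc i.succ)]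
  · have hcoe : (List.ofFn fun i : Fin n => ((c i.succ : ℝ) : Quaternion ℝ)).prod =
        ((∏ i : Fin n, c i.succ : ℝ) : Quaternion ℝ) := by
      change _ = algebraMap ℝ (Quaternion ℝ) (∏ i : Fin n, c i.succ)
      rw [← List.prod_ofFn, map_list_prod, List.map_ofFn]
      rfl
    rw [List.ofFn_succ, List.prod_cons]
    simp only [Fin.cons_zero, Fin.cons_succ]
    rw [hcoe, mul_assoc, ← Quaternion.coe_mul, ← Fin.prod_univ_succ, hQ, huQ]

theorem exists_scale_prod_sqrt_eq {k : ℕ} (x : Fin k → ℝ) (hx : ∀ i, 0 ≤ x i) (Q : ℝ)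
    (hQ : 0 ≤ Q) (hne : Q ≠ 0 ∨ ∃ i, x i ≠ 0) :
    ∃ t : ℝ, 0 < t ∧ (∀ i, t * x i ≤ 1) ∧ ∏ i, √(1 - (t * x i) ^ 2) = t * Q := by
  obtain ⟨o, ho⟩ := Finite.exists_max fun o : Option (Fin k) => o.elim Q x
  set M := o.elim Q x with hM
  have hMQ : Q ≤ M := ho none
  have hMx : ∀ i, x i ≤ M := fun i => ho (some i)
  have hM0 : 0 < M := by
    rcases hne with h | ⟨i, h⟩
    · exact (hQ.lt_of_ne' h).trans_le hMQ
    · exact ((hx i).lt_of_ne' h).trans_le (hMx i)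
  have hle : ∀ t : ℝ, ∏ i, √(1 - (t * x i) ^ 2) ≤ 1 := fun t =>
    Finset.prod_le_one (fun i _ => Real.sqrt_nonneg _) fun i _ => by
      rw [Real.sqrt_le_one]
      nlinarith [sq_nonneg (t * x i)]
  have hcont : Continuous fun t : ℝ => ∏ i, √(1 - (t * x i) ^ 2) - t * Q := by fun_prop
  have hend : ∏ i, √(1 - (M⁻¹ * x i) ^ 2) - M⁻¹ * Q ≤ 0 := by
    rcases o with _ | i
    · have : M⁻¹ * Q = 1 := inv_mul_cancel₀ hM0.ne'
      linarith [hle M⁻¹]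
    · have h1 : M⁻¹ * x i = 1 := inv_mul_cancel₀ hM0.ne'
      rw [Finset.prod_eq_zero (Finset.mem_univ i) (by simp [h1])]
      have : 0 ≤ M⁻¹ * Q := by positivity
      linarith
  obtain ⟨t, ⟨ht0, htM⟩, ht⟩ := intermediate_value_Icc' (inv_nonneg.2 hM0.le) hcont.continuousOn
    (show (0 : ℝ) ∈ _ from ⟨hend, by simp⟩)
  refine ⟨t, ht0.lt_of_ne' ?_, fun i => ?_, sub_eq_zero.1 ht⟩
  · rintro rfl
    simp at ht
  · calc t * x i ≤ M⁻¹ * M := mul_le_mul htM (hMx i) (hx i) (inv_nonneg.2 hM0.le)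
      _ = 1 := inv_mul_cancel₀ hM0.ne'

instance : ProperSpace (Quaternion ℝ) := FiniteDimensional.proper_real _

instance (n : ℕ) : CompactSpace (SpSphere n) := by
  refine isCompact_iff_compactSpace.1 (Metric.isCompact_of_isClosed_isBounded
    (isClosed_eq (by fun_prop) continuous_const) ?_)
  refine (Metric.isBounded_closedBall (x := 0) (r := 1)).subset fun p hp => ?_
  have hp : ‖p.1‖ ^ 2 + ‖p.2‖ ^ 2 = 1 := hp
  rw [mem_closedBall_zero_iff, Prod.norm_def]
  refine max_le ?_ ?_ <;> nlinarith [norm_nonneg p.1, norm_nonneg p.2]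

section spProj

variable {k : ℕ} {m : Fin k → ℕ}

theorem chainExt_ne_zero {G : Type*} [NormedDivisionRing G] {r : Fin (k - 1) → G}
    (hr : ∀ j, ‖r j‖ = 1) (j : ℕ) : chainExt k r j ≠ 0 := by
  unfold chainExt
  split_ifs
  · exact norm_ne_zero_iff.1 (by simp [hr])
  · exact one_ne_zero

theorem spVec_fst (a : ∀ i : Fin k, SpSphere (m i - 3)) (i : Fin k) :
    (spVec k m a).fst i = (a i).1.1 := rfl

theorem spVec_snd (a : ∀ i : Fin k, SpSphere (m i - 3)) :
    (spVec k m a).snd = (List.ofFn fun i => (a i).1.2).prod := rfl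

theorem norm_spVec_snd (a : ∀ i : Fin k, SpSphere (m i - 3)) :
    ‖(spVec k m a).snd‖ = ∏ i, ‖(a i).1.2‖ := norm_prod_ofFn _

theorem spVec_ne_zero (a : ∀ i : Fin k, SpSphere (m i - 3)) : spVec k m a ≠ 0 := by
  intro h
  have hq : ∀ i, ‖(a i).1.2‖ = 1 := fun i => by
    have h1 : (a i).1.1 = 0 := by rw [← spVec_fst, h]; rfl
    have h2 := (a i).2
    rw [h1, norm_zero, zero_pow two_ne_zero, zero_add] at h2
    exact (pow_eq_one_iff_of_nonneg (norm_nonneg _) two_ne_zero).1 h2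
  have h3 := norm_spVec_snd a
  simp [h, hq] at h3

theorem continuous_spVec : Continuous (spVec k m) := by
  have h : Continuous fun a : ∀ i : Fin k, SpSphere (m i - 3) =>
      (List.ofFn fun i => (a i).1.2).prod := by
    simp only [List.ofFn_eq_map]
    exact continuous_list_prod _ fun i _ => by fun_prop
  refine (WithLp.prod_continuous_toLp 2 _ _).comp (Continuous.prodMk ?_ h)
  exact (PiLp.continuous_toLp 2 _).comp (by fun_prop)

theorem continuous_spProj : Continuous (spProj k m) :=
  (continuous_spVec.norm.inv₀ fun a => norm_ne_zero_iff.2 (spVec_ne_zero a)).smul continuous_spVec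

theorem norm_spProj (a : ∀ i : Fin k, SpSphere (m i - 3)) : ‖spProj k m a‖ = 1 :=
  norm_smul_inv_norm (𝕜 := ℝ) (spVec_ne_zero a)

theorem exists_spProj_eq (hk : k ≠ 0) (y : SpTarget k m) (hy : ‖y‖ = 1) :
    ∃ a, spProj k m a = y := by
  obtain ⟨t, ht, htx, htQ⟩ := exists_scale_prod_sqrt_eq (fun i => ‖y.fst i‖)
    (fun i => norm_nonneg _) ‖y.snd‖ (norm_nonneg _) (by
      by_contra! h
      have h0 : y = 0 := by
        refine (WithLp.equiv 2 _).injective (Prod.ext (PiLp.ext fun i => ?_) ?_)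
        · exact norm_eq_zero.1 (h.2 i)
        · exact norm_eq_zero.1 h.1
      simp [h0] at hy)
  obtain ⟨q, hq, hqQ⟩ := exists_prod_ofFn_eq hk _ (fun i => Real.sqrt_nonneg _) (t • y.snd)
    (htQ.trans (by rw [norm_smul, Real.norm_of_nonneg ht.le]))
  let a : ∀ i : Fin k, SpSphere (m i - 3) := fun i => ⟨(t • y.fst i, q i), by
    have h1 : 0 ≤ t * ‖y.fst i‖ := by positivity
    have h2 : 0 ≤ 1 - (t * ‖y.fst i‖) ^ 2 := by nlinarith [htx i]
    rw [hq, Real.sq_sqrt h2, norm_smul, Real.norm_of_nonneg ht.le]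
    ring⟩
  have ha : spVec k m a = t • y :=
    (WithLp.equiv 2 _).injective (Prod.ext (PiLp.ext fun i => rfl) hqQ)
  refine ⟨a, ?_⟩
  rw [spProj, ha, norm_smul, hy, Real.norm_of_nonneg ht.le, mul_one, smul_smul,
    inv_mul_cancel₀ ht.ne', one_smul]

theorem spProj_eq_of_spRel (hk : k ≠ 0) {a b : ∀ i : Fin k, SpSphere (m i - 3)}
    (h : spRel k m a b) : spProj k m a = spProj k m b := by
  obtain ⟨r, hr, h⟩ := h
  have hvec : spVec k m a = spVec k m b := by
    refine (WithLp.equiv 2 _).injective (Prod.ext (PiLp.ext fun i => (h i).1.symm) ?_)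
    change (List.ofFn fun i => (a i).1.2).prod = (List.ofFn fun i => (b i).1.2).prod
    simp only [fun i => (h i).2]
    rw [prod_ofFn_telescope (fun i => (a i).1.2) (chainExt k r) (chainExt_ne_zero hr)]
    have hk' : ¬k ≤ k - 1 := by omega
    simp [chainExt, hk']
  rw [spProj, spProj, hvec]

theorem le_one_of_spVec_eq_smul {a b : ∀ i : Fin k, SpSphere (m i - 3)} {t : ℝ}
    (h : spVec k m b = t • spVec k m a) : t ≤ 1 := by
  by_contra! ht
  have ht0 : 0 ≤ t := by linarith
  have hx : ∀ i, ‖(b i).1.1‖ = t * ‖(a i).1.1‖ := fun i => by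
    rw [← spVec_fst b, h, ← Real.norm_of_nonneg ht0, ← spVec_fst a, ← norm_smul,
      Real.norm_of_nonneg ht0]
    rfl
  have hQ : ∏ i, ‖(b i).1.2‖ = t * ∏ i, ‖(a i).1.2‖ := by
    rw [← norm_spVec_snd, ← norm_spVec_snd, h, WithLp.smul_snd, norm_smul,
      Real.norm_of_nonneg ht0]
  by_cases h0 : ∏ i, ‖(a i).1.2‖ = 0
  · obtain ⟨i, -, hi⟩ := Finset.prod_eq_zero_iff.1 h0
    have h1 := (a i).2
    have h2 := (b i).2
    rw [hi] at h1
    rw [hx i] at h2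
    have h3 : ‖(a i).1.1‖ ^ 2 = 1 := by linarith
    rw [mul_pow, h3] at h2
    nlinarith [sq_nonneg ‖(b i).1.2‖]
  · have hpos : 0 < ∏ i, ‖(a i).1.2‖ :=
      (Finset.prod_nonneg fun i _ => norm_nonneg _).lt_of_ne' h0
    have hle : ∏ i, ‖(b i).1.2‖ ≤ ∏ i, ‖(a i).1.2‖ := by
      refine Finset.prod_le_prod (fun i _ => norm_nonneg _) fun i _ => ?_
      refine le_of_sq_le_sq ?_ (norm_nonneg _)
      have h1 := (a i).2
      have h2 := (b i).2
      have h3 : ‖(a i).1.1‖ ≤ ‖(b i).1.1‖ := by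
        rw [hx i]
        exact le_mul_of_one_le_left (norm_nonneg _) ht.le
      nlinarith [norm_nonneg (a i).1.1]
    nlinarith

theorem spVec_eq_of_spProj_eq {a b : ∀ i : Fin k, SpSphere (m i - 3)}
    (h : spProj k m a = spProj k m b) : spVec k m a = spVec k m b := by
  have hle : ∀ {a b : ∀ i : Fin k, SpSphere (m i - 3)}, spProj k m a = spProj k m b →
      ‖spVec k m b‖ ≤ ‖spVec k m a‖ := by
    intro a b h
    have hb := norm_ne_zero_iff.2 (spVec_ne_zero b)
    have ha := norm_pos_iff.2 (spVec_ne_zero a)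
    have ht : spVec k m b = (‖spVec k m b‖ * ‖spVec k m a‖⁻¹) • spVec k m a := by
      rw [mul_smul]
      change _ = _ • spProj k m a
      rw [h, spProj, smul_smul, mul_inv_cancel₀ hb, one_smul]
    have := le_one_of_spVec_eq_smul ht
    rwa [← div_eq_mul_inv, div_le_one ha] at this
  have hn : ‖spVec k m a‖ = ‖spVec k m b‖ := le_antisymm (hle h.symm) (hle h)
  rw [spProj, spProj, hn] at h
  exact smul_right_injective _ (inv_ne_zero (norm_ne_zero_iff.2 (spVec_ne_zero b))) h

theorem spRel_of_spVec_eq {a b : ∀ i : Fin k, SpSphere (m i - 3)}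
    (h : spVec k m a = spVec k m b) : spRel k m a b := by
  have hx : ∀ i, (b i).1.1 = (a i).1.1 := fun i => by rw [← spVec_fst, ← h, spVec_fst]
  have hq : ∀ i, ‖(b i).1.2‖ = ‖(a i).1.2‖ := fun i => by
    have h1 := (a i).2
    have h2 := (b i).2
    rw [hx] at h2
    exact (sq_eq_sq₀ (norm_nonneg _) (norm_nonneg _)).1 (by linarith)
  obtain ⟨s, hs, hs0, hsk, hsq⟩ := exists_unit_chain_of_prod_eq (fun i => (a i).1.2)
    (fun i => (b i).1.2) hq 1 norm_one (by rw [one_mul, ← spVec_snd, ← spVec_snd, h])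
  refine ⟨fun j => s (j + 1), fun j => hs _, fun i => ⟨hx i, ?_⟩⟩
  have hext : ∀ j ≤ k, chainExt k (fun j : Fin (k - 1) => s (j + 1)) j = s j := by
    intro j hj
    unfold chainExt
    split_ifs with hj'
    · exact congrArg s (Nat.sub_add_cancel hj'.1)
    · obtain rfl | rfl : j = 0 ∨ j = k := by omega
      exacts [hs0.symm, hsk.symm]
  rw [hext _ i.2.le, hext _ i.2]
  exact hsq i

end spProj

/-- `p` is continuous, takes values in the unit sphere `S^m`, is surjective onto
`S^m`, is constant on `Sp(1)^{k-1}`-orbits, and induces a homeomorphism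
`(S^{m₁} × ⋯ × S^{m_k})/Sp(1)^{k-1} ≃ₜ S^m`. -/
theorem stmt5 (k : ℕ) (hk : 2 ≤ k) (m : Fin k → ℕ) (hm : ∀ i, 4 ≤ m i) :
    Continuous (spProj k m) ∧
    (∀ a, ‖spProj k m a‖ = 1) ∧
    (∀ y : SpTarget k m, ‖y‖ = 1 → ∃ a, spProj k m a = y) ∧
    (∀ a b, spRel k m a b → spProj k m a = spProj k m b) ∧
    ∃ h : Quot (spRel k m) ≃ₜ Metric.sphere (0 : SpTarget k m) 1,
      ∀ a, (h (Quot.mk _ a)).1 = spProj k m a := by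
  have hk0 : k ≠ 0 := by omega
  refine ⟨continuous_spProj, norm_spProj, exists_spProj_eq hk0,
    fun a b => spProj_eq_of_spRel hk0, ?_⟩
  let f : Quot (spRel k m) → Metric.sphere (0 : SpTarget k m) 1 :=
    Quot.lift (fun a => ⟨spProj k m a, by simp [norm_spProj]⟩)
      fun a b h => Subtype.ext (spProj_eq_of_spRel hk0 h)
  have hf : Continuous f := continuous_quot_lift _ (continuous_spProj.subtype_mk _)
  have hbij : Function.Bijective f := by
    constructor
    · rintro ⟨a⟩ ⟨b⟩ h
      exact Quot.sound (spRel_of_spVec_eq (spVec_eq_of_spProj_eq (congrArg Subtype.val h)))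
    · rintro ⟨y, hy⟩
      obtain ⟨a, ha⟩ := exists_spProj_eq hk0 y (by simpa using hy)
      exact ⟨Quot.mk _ a, Subtype.ext ha⟩
  exact ⟨Continuous.homeoOfEquivCompactToT2 (f := Equiv.ofBijective f hbij) hf, fun a => rfl⟩
end
end
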